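/- Let M₂ be the Turing machine with states {A,B,H} and symbols {0,1,2,3} whose transition table is: δ(A,0)=(1,R,B), δ(A,1)=(2,L,A), δ(A,2)=(1,R,A), δ(A,3)=(1,R,A); δ(B,0)=(1,L,B), δ(B,1)=(1,L,A), δ(B,2)=(3,R,B), δ(B,3)=(1,R,H). Let C(n,1) = ^ω0 (A0) 2^n 1 0^ω and C(n,2) = ^ω0 (A0) 2^n 1 1 0^ω. Then: (a) ^ω0 (A0) 0^ω ⊢(6) C(1,2); and for all k ≥ 0: (b) C(3k,1) ⊢(15k²+9k+3) C(5k+1,1); (c) C(3k+1,1) ⊢(15k²+24k+13) ^ω0 1 3^{5k+2} 1 (H1) 0^ω; (d) C(3k+2,1) ⊢(15k²+29k+17) C(5k+4,2); (e) C(3k,2) ⊢(15k²+11k+3) C(5k+1,2); (f) C(3k+1,2) ⊢(15k²+21k+7) C(5k+3,1); (g) C(3k+2,2) ⊢(15k²+36k+23) ^ω0 1 3^{5k+4} 1 (H1) 0^ω. -/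

import Mathlib

open Turing

inductive TSt where | A | B | H
deriving DecidableEq

inductive Gam where | s0 | s1 | s2 | s3
deriving DecidableEq

instance : Inhabited Gam := ⟨Gam.s0⟩

abbrev Cfg := TSt × Tape Gam

/-- The transition table of the machine (values from the halting state `H` are never used). -/
def delta : TSt → Gam → Gam × Dir × TSt
  | .A, .s0 => (.s1, Dir.right, .B)
  | .A, .s1 => (.s2, Dir.left, .A)
  | .A, .s2 => (.s1, Dir.right, .A)
  | .A, .s3 => (.s1, Dir.right, .A)
  | .B, .s0 => (.s1, Dir.left, .B)
  | .B, .s1 => (.s1, Dir.left, .A)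
  | .B, .s2 => (.s3, Dir.right, .B)
  | .B, .s3 => (.s1, Dir.right, .H)
  | .H, a => (a, Dir.right, .H)

/-- One computation step; `none` if the current state is the halting state `H`. -/
def step (c : Cfg) : Option Cfg :=
  if c.1 = TSt.H then none
  else
    let t := delta c.1 c.2.head
    some (t.2.2, (c.2.write t.1).move t.2.1)

/-- `reaches t c₁ c₂` : iterating `step` exactly `t` times starting from `c₁` yields `c₂`. -/
def reaches (t : ℕ) (c₁ c₂ : Cfg) : Prop :=
  (fun c => Option.bind c step)^[t] (some c₁) = some c₂

/-- The configuration `^ω0 x (q a) y 0^ω` : state `q`, head reading `a`, the word `x`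
written immediately to the left of the head (in order), `y` immediately to the right,
blank elsewhere. -/
def mkCfg (x : List Gam) (q : TSt) (a : Gam) (y : List Gam) : Cfg :=
  (q, ⟨a, ListBlank.mk x.reverse, ListBlank.mk y⟩)

/-- `C(n,1) = ^ω0 (A0) 2^n 1 0^ω`, `C(n,2) = ^ω0 (A0) 2^n 1 1 0^ω`. -/
def Cfg2 (n i : ℕ) : Cfg :=
  mkCfg [] .A .s0 (List.replicate n .s2 ++ List.replicate i .s1)

theorem reaches_zero (c : Cfg) : reaches 0 c c := rfl

theorem reaches.trans {s t u : ℕ} {a b c : Cfg} (hab : reaches s a b) (hbc : reaches t b c)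
    (hu : u = s + t) : reaches u a c := by
  subst hu
  unfold reaches at *
  rw [add_comm, Function.iterate_add_apply, hab, hbc]

theorem reaches_one {a b : Cfg} (h : step a = some b) : reaches 1 a b := h

theorem reaches.cons {t u : ℕ} {a b c : Cfg} (hab : step a = some b) (hbc : reaches t b c)
    (hu : u = t + 1) : reaches u a c :=
  (reaches_one hab).trans hbc (by omega)

/-- The half-tape consisting of `n` copies of `a` followed by `L`. -/
def pow (a : Gam) (n : ℕ) (L : ListBlank Gam) : ListBlank Gam :=
  (ListBlank.cons a)^[n] L

@[simp] theorem pow_zero_apply (a : Gam) (L : ListBlank Gam) : pow a 0 L = L := rfl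

theorem pow_succ_apply (a : Gam) (n : ℕ) (L : ListBlank Gam) :
    pow a (n + 1) L = (pow a n L).cons a :=
  Function.iterate_succ_apply' _ _ _

theorem pow_cons (a : Gam) (n : ℕ) (L : ListBlank Gam) :
    pow a n (L.cons a) = pow a (n + 1) L := rfl

theorem mk_replicate_append (a : Gam) (n : ℕ) (l : List Gam) :
    ListBlank.mk (List.replicate n a ++ l) = pow a n (ListBlank.mk l) := by
  induction n with
  | zero => rfl
  | succ n ih => rw [pow_succ_apply, ← ih, ListBlank.cons_mk]; rfl

/-- The blank half-tape. -/
def blank : ListBlank Gam := ListBlank.mk []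

theorem blank_head : blank.head = .s0 := rfl

theorem blank_tail : blank.tail = blank := rfl

theorem cons_blank : blank.cons .s0 = blank := by
  conv_rhs => rw [← ListBlank.cons_head_tail blank, blank_head, blank_tail]

/-- The head reads the last cell of the left half-tape `L`. -/
def onLeft (q : TSt) (L R : ListBlank Gam) : Cfg := (q, ⟨L.head, L.tail, R⟩)

/-- The head reads the first cell of the right half-tape `R`. -/
def onRight (q : TSt) (L R : ListBlank Gam) : Cfg := (q, ⟨R.head, L, R.tail⟩)

theorem onLeft_cons_eq_onRight (q : TSt) (a : Gam) (L R : ListBlank Gam) :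
    onLeft q (L.cons a) R = onRight q L (R.cons a) := by
  simp [onLeft, onRight]

theorem onLeft_blank_eq_onRight (q : TSt) (R : ListBlank Gam) :
    onLeft q blank R = onRight q blank (R.cons .s0) := by
  rw [← onLeft_cons_eq_onRight, cons_blank]

theorem onRight_blank (q : TSt) (L : ListBlank Gam) :
    onRight q L blank = onRight q L (blank.cons .s0) := by
  rw [cons_blank]

theorem step_onRight_right {q q' : TSt} {a b : Gam} (hq : q ≠ .H)
    (h : delta q a = (b, Dir.right, q')) (L R : ListBlank Gam) :
    step (onRight q L (R.cons a)) = some (onRight q' (L.cons b) R) := by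
  simp [step, onRight, hq, h, Tape.move, Tape.write]

theorem step_onRight_left {q q' : TSt} {a b : Gam} (hq : q ≠ .H)
    (h : delta q a = (b, Dir.left, q')) (L R : ListBlank Gam) :
    step (onRight q L (R.cons a)) = some (onLeft q' L (R.cons b)) := by
  simp [step, onRight, onLeft, hq, h, Tape.move, Tape.write]

theorem step_onLeft_right {q q' : TSt} {a b : Gam} (hq : q ≠ .H)
    (h : delta q a = (b, Dir.right, q')) (L R : ListBlank Gam) :
    step (onLeft q (L.cons a) R) = some (onRight q' (L.cons b) R) := by
  rw [onLeft_cons_eq_onRight, step_onRight_right hq h]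

theorem step_onLeft_left {q q' : TSt} {a b : Gam} (hq : q ≠ .H)
    (h : delta q a = (b, Dir.left, q')) (L R : ListBlank Gam) :
    step (onLeft q (L.cons a) R) = some (onLeft q' L (R.cons b)) := by
  rw [onLeft_cons_eq_onRight, step_onRight_left hq h]

theorem sweep_right {q : TSt} {a b : Gam} (hq : q ≠ .H) (h : delta q a = (b, Dir.right, q))
    (n : ℕ) (L R : ListBlank Gam) :
    reaches n (onRight q L (pow a n R)) (onRight q (pow b n L) R) := by
  induction n generalizing L with
  | zero => exact reaches_zero _
  | succ n ih =>
    rw [pow_succ_apply, ← pow_cons]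
    exact (ih _).cons (step_onRight_right hq h _ _) rfl

theorem sweep_left {q : TSt} {a b : Gam} (hq : q ≠ .H) (h : delta q a = (b, Dir.left, q))
    (n : ℕ) (L R : ListBlank Gam) :
    reaches n (onLeft q (pow a n L) R) (onLeft q L (pow b n R)) := by
  induction n generalizing R with
  | zero => exact reaches_zero _
  | succ n ih =>
    rw [pow_succ_apply, ← pow_cons]
    exact (ih _).cons (step_onLeft_left hq h _ _) rfl

/-- The configuration `^ω0 1 3^m (A at the last cell of this word) 2^n 1^i 0^ω`. -/
def turn (m n i : ℕ) : Cfg :=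
  onLeft .A (pow .s3 m (blank.cons .s1)) (pow .s2 n (pow .s1 i blank))

theorem turn_sweep_right (m n : ℕ) (L R : ListBlank Gam) :
    reaches (n + 1) (onLeft .A (pow .s3 (m + 1) L) (pow .s2 n R))
      (onRight .A (pow .s1 (n + 1) (pow .s3 m L)) R) := by
  rw [pow_succ_apply, ← pow_cons]
  exact (sweep_right (by decide) rfl n _ _).cons (step_onLeft_right (by decide) rfl _ _) rfl

theorem turn_succ_succ (m n i : ℕ) :
    reaches (2 * n + 3) (turn (m + 1) n (i + 1)) (turn m (n + 2) i) := by
  refine (turn_sweep_right m n _ _).trans (t := n + 2) ?_ (by ring)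
  rw [pow_succ_apply .s1 i]
  refine reaches.cons (step_onRight_left (by decide) rfl _ _) ?_ rfl
  exact sweep_left (by decide) rfl (n + 1) _ _

theorem turn_succ_zero (m n : ℕ) :
    reaches (2 * n + 5) (turn (m + 1) n 0) (turn m (n + 1) 2) := by
  refine (turn_sweep_right m n _ _).trans (t := n + 4) ?_ (by ring)
  rw [pow_zero_apply, onRight_blank]
  refine reaches.cons (step_onRight_right (by decide) rfl _ _) ?_ rfl
  rw [onRight_blank]
  refine reaches.cons (step_onRight_left (by decide) rfl _ _) ?_ rfl
  refine reaches.cons (step_onLeft_left (by decide) rfl _ _) ?_ rfl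
  exact sweep_left (by decide) rfl (n + 1) _ _

theorem turn_add_three (m n i : ℕ) (hi : i ≤ 2) :
    reaches (6 * n + 19 + 2 * i) (turn (m + 3) n i) (turn m (n + 5) i) := by
  interval_cases i
  · exact (turn_succ_zero _ _).trans
      ((turn_succ_succ _ _ _).trans (turn_succ_succ _ _ _) rfl) (by ring)
  · exact (turn_succ_succ _ _ _).trans
      ((turn_succ_zero _ _).trans (turn_succ_succ _ _ _) rfl) (by ring)
  · exact (turn_succ_succ _ _ _).trans
      ((turn_succ_succ _ _ _).trans (turn_succ_zero _ _) rfl) (by ring)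

theorem turn_add_three_mul (k m n i : ℕ) (hi : i ≤ 2) :
    reaches (15 * k ^ 2 + 6 * n * k + (4 + 2 * i) * k)
      (turn (3 * k + m) n i) (turn m (5 * k + n) i) := by
  induction k generalizing n with
  | zero => simpa using reaches_zero _
  | succ k ih =>
    have h := turn_add_three (3 * k + m) n i hi
    rw [show 3 * k + m + 3 = 3 * (k + 1) + m by ring] at h
    have h' := ih (n + 5)
    rw [show 5 * k + (n + 5) = 5 * (k + 1) + n by ring] at h'
    exact h.trans h' (by ring)

theorem Cfg2_eq_onLeft (n i : ℕ) :
    Cfg2 n i = onLeft .A blank (pow .s2 n (pow .s1 i blank)) := by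
  have h := mk_replicate_append .s1 i []
  rw [List.append_nil] at h
  rw [Cfg2, mkCfg, mk_replicate_append, h]
  rfl

theorem Cfg2_sweep_right (n i : ℕ) :
    reaches (n + 1) (Cfg2 n i)
      (onRight .B (pow .s3 n (blank.cons .s1)) (pow .s1 i blank)) := by
  rw [Cfg2_eq_onLeft, onLeft_blank_eq_onRight]
  exact (sweep_right (by decide) rfl n _ _).cons (step_onRight_right (by decide) rfl _ _) rfl

theorem Cfg2_reaches_turn (n i : ℕ) :
    reaches (n + 2) (Cfg2 n (i + 1)) (turn n 0 (i + 1)) := by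
  refine (Cfg2_sweep_right n (i + 1)).trans (t := 1) (reaches_one ?_) rfl
  rw [turn, pow_succ_apply .s1 i]
  exact step_onRight_left (by decide) rfl _ _

theorem Cfg2_reaches_turn_add (k m i : ℕ) (hi : i < 2) :
    reaches (15 * k ^ 2 + (9 + 2 * i) * k + m + 2)
      (Cfg2 (3 * k + m) (i + 1)) (turn m (5 * k) (i + 1)) :=
  (Cfg2_reaches_turn _ _).trans (turn_add_three_mul k m 0 (i + 1) hi) (by ring)

theorem turn_zero (n i : ℕ) : reaches 1 (turn 0 n i) (Cfg2 (n + 1) i) := by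
  rw [Cfg2_eq_onLeft, pow_succ_apply, turn, pow_zero_apply]
  exact reaches_one (step_onLeft_left (by decide) rfl _ _)

theorem turn_zero_halts (n : ℕ) :
    reaches (n + 5) (turn 0 n 0)
      (mkCfg ([.s1] ++ List.replicate n .s3 ++ [.s1]) .H .s1 []) := by
  refine (turn_zero n 0).trans ((Cfg2_sweep_right (n + 1) 0).trans (t := 2) ?_ rfl) (by ring)
  rw [pow_zero_apply, onRight_blank]
  refine reaches.cons (step_onRight_left (by decide) rfl _ _) (reaches_one ?_) rfl
  rw [pow_succ_apply, step_onLeft_right (by decide) rfl]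
  have hL : ListBlank.mk ([Gam.s1] ++ List.replicate n Gam.s3 ++ [Gam.s1]).reverse =
      (pow .s3 n (blank.cons .s1)).cons .s1 := by
    rw [List.reverse_append, List.reverse_append, List.reverse_replicate, List.reverse_singleton,
      List.singleton_append, ← ListBlank.cons_mk, mk_replicate_append]
    rfl
  rw [mkCfg, hL]
  simp [onRight, blank]

theorem stmt3 :
    reaches 6 (mkCfg [] .A .s0 []) (Cfg2 1 2) ∧
    ∀ k : ℕ,
      reaches (15*k^2 + 9*k + 3) (Cfg2 (3*k) 1) (Cfg2 (5*k+1) 1) ∧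
      reaches (15*k^2 + 24*k + 13) (Cfg2 (3*k+1) 1)
        (mkCfg ([.s1] ++ List.replicate (5*k+2) .s3 ++ [.s1]) .H .s1 []) ∧
      reaches (15*k^2 + 29*k + 17) (Cfg2 (3*k+2) 1) (Cfg2 (5*k+4) 2) ∧
      reaches (15*k^2 + 11*k + 3) (Cfg2 (3*k) 2) (Cfg2 (5*k+1) 2) ∧
      reaches (15*k^2 + 21*k + 7) (Cfg2 (3*k+1) 2) (Cfg2 (5*k+3) 1) ∧
      reaches (15*k^2 + 36*k + 23) (Cfg2 (3*k+2) 2)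
        (mkCfg ([.s1] ++ List.replicate (5*k+4) .s3 ++ [.s1]) .H .s1 []) := by
  refine ⟨?_, fun k => ⟨?_, ?_, ?_, ?_, ?_, ?_⟩⟩
  · rfl
  · exact (Cfg2_reaches_turn_add k 0 0 (by decide)).trans (turn_zero _ _) (by ring)
  · exact (Cfg2_reaches_turn_add k 1 0 (by decide)).trans
      ((turn_succ_succ _ _ _).trans (turn_zero_halts _) rfl) (by ring)
  · exact (Cfg2_reaches_turn_add k 2 0 (by decide)).trans
      ((turn_succ_succ _ _ _).trans ((turn_succ_zero _ _).trans (turn_zero _ _) rfl) rfl) (by ring)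
  · exact (Cfg2_reaches_turn_add k 0 1 (by decide)).trans (turn_zero _ _) (by ring)
  · exact (Cfg2_reaches_turn_add k 1 1 (by decide)).trans
      ((turn_succ_succ _ _ _).trans (turn_zero _ _) rfl) (by ring)
  · exact (Cfg2_reaches_turn_add k 2 1 (by decide)).trans
      ((turn_succ_succ _ _ _).trans ((turn_succ_succ _ _ _).trans (turn_zero_halts _) rfl) rfl)
      (by ring)
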